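/- Let d ≥ 6 be even and set k = d/2. Let a₁, …, a_{k−1}, q ∈ ℂ be pairwise distinct. In S = ℂ[x,y,z] define A_i = ((x − a_i z)², y²) for 1 ≤ i ≤ k−1, and let T = (x − qz, y)³ be the cube of the ideal of the point Q = [q : 0 : 1]. Let J ⊆ S be any homogeneous ideal with J : (y) = J. Then dim_ℂ ( A₁ ∩ ⋯ ∩ A_{k−1} ∩ T ∩ J )_d = dim_ℂ ( J ∩ (x − qz, y) )_{d−2}. -/

import Mathlib

open MvPolynomial

/-- The dimension of the degree-`d` homogeneous part of a (homogeneous) ideal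
`I ⊆ ℂ[x,y,z]`, as a `ℂ`-vector space. -/
noncomputable def hdim (I : Ideal (MvPolynomial (Fin 3) ℂ)) (d : ℕ) : ℕ :=
  Module.finrank ℂ
    ((Submodule.restrictScalars ℂ I ⊓ homogeneousSubmodule (Fin 3) ℂ d :
      Submodule ℂ (MvPolynomial (Fin 3) ℂ)))

local notation "x" => (X 0 : MvPolynomial (Fin 3) ℂ)
local notation "y" => (X 1 : MvPolynomial (Fin 3) ℂ)
local notation "z" => (X 2 : MvPolynomial (Fin 3) ℂ)

/-- Dehomogenised restriction to the line `y = 0`. -/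
noncomputable def restrictLine : MvPolynomial (Fin 3) ℂ →ₐ[ℂ] Polynomial ℂ :=
  aeval ![Polynomial.X, 0, 1]

lemma coeff_restrictLine {f : MvPolynomial (Fin 3) ℂ} {d : ℕ} (hf : f.IsHomogeneous d) (n : ℕ) :
    (restrictLine f).coeff n =
      f.coeff (Finsupp.single 0 n + Finsupp.single 2 (d - n)) := by
  set e : Fin 3 →₀ ℕ := Finsupp.single 0 n + Finsupp.single 2 (d - n) with he
  have hterm : ∀ m ∈ f.support,
      (algebraMap ℂ (Polynomial ℂ) (f.coeff m) *
        ∏ i, (![Polynomial.X, 0, 1] : Fin 3 → Polynomial ℂ) i ^ m i).coeff n =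
      if m = e then f.coeff m else 0 := by
    intro m hm
    have hdeg : m.degree = d := (hf.degree_eq_sum_deg_support hm).symm
    rw [Finsupp.degree_eq_sum, Fin.sum_univ_three] at hdeg
    have hme : m = e ↔ m 1 = 0 ∧ m 0 = n := by
      constructor
      · rintro rfl
        simp [he]
      · rintro ⟨h1, h0⟩
        ext i
        fin_cases i
        · simp [he, h0]
        · simp [he, h1]
        · simp [he]
          omega
    rw [Polynomial.algebraMap_eq, Polynomial.coeff_C_mul, Fin.prod_univ_three]
    by_cases h1 : m 1 = 0
    · simp [h1, hme, Polynomial.coeff_X_pow, eq_comm]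
    · simp [h1, hme]
  rw [restrictLine, aeval_def, eval₂_eq', Polynomial.finsetSum_coeff,
    Finset.sum_congr rfl hterm, Finset.sum_ite_eq' f.support e]
  split_ifs with h
  · rfl
  · exact (notMem_support_iff.mp h).symm

lemma natDegree_restrictLine_le {f : MvPolynomial (Fin 3) ℂ} {d : ℕ} (hf : f.IsHomogeneous d) :
    (restrictLine f).natDegree ≤ d := by
  rw [Polynomial.natDegree_le_iff_coeff_eq_zero]
  intro n hn
  rw [coeff_restrictLine hf]
  refine hf.coeff_eq_zero ?_
  simp [Finsupp.degree_eq_sum, Fin.sum_univ_three]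
  omega

lemma X_dvd_of_restrictLine_eq_zero {f : MvPolynomial (Fin 3) ℂ} {d : ℕ}
    (hf : f.IsHomogeneous d) (h : restrictLine f = 0) : y ∣ f := by
  rw [X_dvd_iff_modMonomial_eq_zero]
  ext m
  by_cases hle : Finsupp.single 1 1 ≤ m
  · rw [coeff_modMonomial_of_le _ hle, coeff_zero]
  · rw [coeff_modMonomial_of_not_le _ hle, coeff_zero]
    by_contra hm
    have hdeg : m.degree = d := (hf.degree_eq_sum_deg_support (mem_support_iff.mpr hm)).symm
    rw [Finsupp.degree_eq_sum, Fin.sum_univ_three] at hdeg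
    have h1 : m 1 = 0 := by
      rw [Finsupp.single_le_iff] at hle
      omega
    refine hm ?_
    have hme : m = Finsupp.single 0 (m 0) + Finsupp.single 2 (d - m 0) := by
      ext i
      fin_cases i
      · simp
      · simp [h1]
      · simp
        omega
    rw [hme, ← coeff_restrictLine hf, h, Polynomial.coeff_zero]

lemma isHomogeneous_of_X_mul {f : MvPolynomial (Fin 3) ℂ} {d : ℕ} (i : Fin 3)
    (hf : (X i * f).IsHomogeneous (d + 1)) : f.IsHomogeneous d := by
  intro m hm
  rw [← coeff_X_mul m i f] at hm
  have h := hf hm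
  simp only [map_add, Finsupp.weight_single, Pi.one_apply, smul_eq_mul, mul_one] at h
  lia

lemma restrictLine_linear (b : ℂ) :
    restrictLine (x - C b * z) = Polynomial.X - Polynomial.C b := by
  rw [← algebraMap_eq]
  simp [restrictLine, aeval_def]

lemma X_one_dvd_of_dvd_mul_linear_pow {u : MvPolynomial (Fin 3) ℂ} {b : ℂ} {n : ℕ}
    (h : y ∣ (x - C b * z) ^ n * u) : y ∣ u := by
  have hy : Prime y := X_prime
  refine (hy.dvd_or_dvd h).resolve_left fun hL => ?_
  have h0 := map_dvd restrictLine (hy.dvd_of_dvd_pow hL)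
  rw [restrictLine_linear] at h0
  have hy0 : restrictLine y = 0 := by simp [restrictLine]
  rw [hy0, zero_dvd_iff] at h0
  exact Polynomial.X_sub_C_ne_zero b h0

lemma span_pair_pow_succ_le {R : Type*} [CommRing R] (l w : R) (n : ℕ) :
    Ideal.span {l, w} ^ (n + 1) ≤
      Ideal.span {l ^ (n + 1)} ⊔ Ideal.span {w} * Ideal.span {l, w} ^ n := by
  induction n with
  | zero => simp [Ideal.span_insert]
  | succ n ih =>
    have hw : Ideal.span {w} ≤ Ideal.span {l, w} := Ideal.span_mono (by simp)
    have hl : Ideal.span {l} ≤ Ideal.span {l, w} := Ideal.span_mono (by simp)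
    have hlp : Ideal.span {l ^ (n + 1)} ≤ Ideal.span {l, w} ^ (n + 1) := by
      rw [← Ideal.span_singleton_pow]
      exact Ideal.pow_right_mono hl _
    calc Ideal.span {l, w} ^ (n + 1 + 1)
        = Ideal.span {l, w} ^ (n + 1) * Ideal.span {l, w} := pow_succ _ _
      _ ≤ (Ideal.span {l ^ (n + 1)} ⊔ Ideal.span {w} * Ideal.span {l, w} ^ n) *
            Ideal.span {l, w} := Ideal.mul_mono_left ih
      _ = Ideal.span {l ^ (n + 1)} * (Ideal.span {l} ⊔ Ideal.span {w}) ⊔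
            Ideal.span {w} * Ideal.span {l, w} ^ (n + 1) := by
          rw [Ideal.sup_mul, mul_assoc, ← pow_succ, Ideal.span_insert]
      _ ≤ _ := by
          rw [Ideal.mul_sup, Ideal.span_singleton_mul_span_singleton, ← pow_succ]
          refine sup_le (sup_le le_sup_left (le_sup_of_le_right ?_)) le_sup_right
          rw [mul_comm]
          exact Ideal.mul_mono_right hlp

lemma mem_pow_of_X_mul_mem {g : MvPolynomial (Fin 3) ℂ} {b : ℂ} {n : ℕ}
    (h : y * g ∈ Ideal.span {x - C b * z, y} ^ (n + 1)) :
    g ∈ Ideal.span {x - C b * z, y} ^ n := by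
  obtain ⟨s, hs, t, ht, hst⟩ := Submodule.mem_sup.mp (span_pair_pow_succ_le _ _ _ h)
  obtain ⟨u, rfl⟩ := Ideal.mem_span_singleton'.mp hs
  obtain ⟨v, hv, rfl⟩ := Ideal.mem_span_singleton_mul.mp ht
  obtain ⟨u', rfl⟩ : y ∣ u :=
    X_one_dvd_of_dvd_mul_linear_pow (n := n + 1) (b := b)
      ⟨g - v, by linear_combination hst⟩
  have hg : g = v + u' * (x - C b * z) * (x - C b * z) ^ n :=
    mul_left_cancel₀ (X_ne_zero (1 : Fin 3)) (by linear_combination -hst)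
  rw [hg]
  exact add_mem hv (Ideal.mul_mem_left _ _
    (Ideal.pow_mem_pow (Ideal.subset_span (by simp)) n))

lemma restrictLine_dvd_of_mem_pow {g : MvPolynomial (Fin 3) ℂ} {b : ℂ} {n : ℕ}
    (h : g ∈ Ideal.span {x - C b * z, y} ^ n) :
    (Polynomial.X - Polynomial.C b) ^ n ∣ restrictLine g := by
  have h1 := Ideal.mem_map_of_mem restrictLine h
  have hy0 : restrictLine y = 0 := by simp [restrictLine]
  rw [Ideal.map_pow, Ideal.map_span, Set.image_pair, restrictLine_linear, hy0,
    Set.pair_comm, Ideal.span_insert_zero, Ideal.span_singleton_pow,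
    Ideal.mem_span_singleton] at h1
  exact h1

lemma restrictLine_dvd_of_mem_square {g : MvPolynomial (Fin 3) ℂ} {b : ℂ}
    (h : g ∈ Ideal.span {(x - C b * z) ^ 2, y ^ 2}) :
    (Polynomial.X - Polynomial.C b) ^ 2 ∣ restrictLine g := by
  obtain ⟨u, v, rfl⟩ := Ideal.mem_span_pair.mp h
  have hy0 : restrictLine y = 0 := by simp [restrictLine]
  rw [map_add, map_mul, map_mul, map_pow, map_pow, restrictLine_linear, hy0]
  exact ⟨restrictLine u, by ring⟩

lemma restrictLine_dvd_of_X_mul_mem_square {g : MvPolynomial (Fin 3) ℂ} {b : ℂ}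
    (h : y * g ∈ Ideal.span {(x - C b * z) ^ 2, y ^ 2}) :
    (Polynomial.X - Polynomial.C b) ^ 2 ∣ restrictLine g := by
  obtain ⟨u, v, huv⟩ := Ideal.mem_span_pair.mp h
  obtain ⟨u', rfl⟩ : y ∣ u :=
    X_one_dvd_of_dvd_mul_linear_pow (n := 2) (b := b)
      ⟨g - v * y, by linear_combination huv⟩
  have hg : g = v * y + u' * (x - C b * z) ^ 2 :=
    mul_left_cancel₀ (X_ne_zero (1 : Fin 3)) (by linear_combination -huv)
  have hy0 : restrictLine y = 0 := by simp [restrictLine]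
  rw [hg, map_add, map_mul, map_mul, map_pow, restrictLine_linear, hy0]
  exact ⟨restrictLine u', by ring⟩

lemma polynomial_eq_zero_of_multiple_roots {p : Polynomial ℂ} {n m d : ℕ} {a : ℕ → ℂ} {q : ℂ}
    (ha : ∀ i < n, ∀ j < n, a i = a j → i = j) (haq : ∀ i < n, a i ≠ q)
    (hp : p.natDegree ≤ d) (hd : d < 2 * n + m)
    (hpa : ∀ i < n, (Polynomial.X - Polynomial.C (a i)) ^ 2 ∣ p)
    (hpq : (Polynomial.X - Polynomial.C q) ^ m ∣ p) : p = 0 := by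
  have hcop : ∀ {b c : ℂ}, b ≠ c →
      IsCoprime (Polynomial.X - Polynomial.C b) (Polynomial.X - Polynomial.C c) :=
    fun h => Polynomial.isCoprime_X_sub_C_of_isUnit_sub (sub_ne_zero.mpr h).isUnit
  have hprod : ∏ i ∈ Finset.range n, (Polynomial.X - Polynomial.C (a i)) ^ 2 ∣ p := by
    refine Finset.prod_dvd_of_coprime (fun i hi j hj hij => ?_)
      fun i hi => hpa i (Finset.mem_range.mp hi)
    exact (hcop fun h => hij (ha i (by simpa using hi) j (by simpa using hj) h)).pow
  have hall : (∏ i ∈ Finset.range n, (Polynomial.X - Polynomial.C (a i)) ^ 2) *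
      (Polynomial.X - Polynomial.C q) ^ m ∣ p :=
    (IsCoprime.prod_left fun i hi => (hcop (haq i (Finset.mem_range.mp hi))).pow).mul_dvd
      hprod hpq
  refine Polynomial.eq_zero_of_dvd_of_natDegree_lt hall (hp.trans_lt ?_)
  have hmon : ∀ i ∈ Finset.range n, ((Polynomial.X - Polynomial.C (a i)) ^ 2).Monic :=
    fun i _ => (Polynomial.monic_X_sub_C _).pow 2
  rw [(Polynomial.monic_prod_of_monic _ _ hmon).natDegree_mul
    ((Polynomial.monic_X_sub_C q).pow m), Polynomial.natDegree_prod_of_monic _ _ hmon]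
  simp only [Polynomial.natDegree_pow, Polynomial.natDegree_X_sub_C, Finset.sum_const,
    Finset.card_range, smul_eq_mul]
  omega

/-- The Horace reduction for the even-degree case of the theorem on a general
union of 2-squares and one 3-fat point: `k-1` 2-squares of type (1.a) on the
line `r : y = 0`, the triple point at `Q = [q:0:1] ∈ r`, and a residual
scheme not meeting `r`. -/
theorem stmt_6 (d k : ℕ) (hd6 : 6 ≤ d) (hdk : d = 2 * k)
    (a : ℕ → ℂ) (q : ℂ)
    (ha : ∀ i < k - 1, ∀ j < k - 1, a i = a j → i = j)
    (haq : ∀ i < k - 1, a i ≠ q)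
    (J : Ideal (MvPolynomial (Fin 3) ℂ))
    (hJhom : ∀ f ∈ J, ∀ n : ℕ, homogeneousComponent n f ∈ J)
    (hJres : J.colon (Ideal.span {y}) = J) :
    hdim ((⨅ i ∈ Finset.range (k - 1), Ideal.span {(x - C (a i) * z) ^ 2, y ^ 2}) ⊓
        (Ideal.span {x - C q * z, y}) ^ 3 ⊓ J) d =
      hdim (J ⊓ Ideal.span {x - C q * z, y}) (d - 2) := by
  obtain ⟨e, rfl⟩ : ∃ e, d = e + 2 := ⟨d - 2, by omega⟩
  have hJy : ∀ {g}, y * g ∈ J → g ∈ J := by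
    intro g hg
    rw [← hJres, Submodule.mem_colon]
    intro p hp
    obtain ⟨c, rfl⟩ := Ideal.mem_span_singleton'.mp hp
    have : g • (c * y) = c * (y * g) := by rw [smul_eq_mul]; ring
    rw [this]
    exact J.mul_mem_left c hg
  have hinj : Function.Injective (LinearMap.mulLeft ℂ (y ^ 2)) :=
    fun _ _ h => mul_left_cancel₀ (pow_ne_zero 2 (X_ne_zero (1 : Fin 3))) h
  unfold hdim
  rw [Nat.add_sub_cancel, (Submodule.equivMapOfInjective _ hinj
    (Submodule.restrictScalars ℂ (J ⊓ Ideal.span {x - C q * z, y}) ⊓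
      homogeneousSubmodule (Fin 3) ℂ e)).finrank_eq]
  refine congrArg
    (fun N : Submodule ℂ (MvPolynomial (Fin 3) ℂ) => Module.finrank ℂ N) ?_
  ext f
  simp only [Submodule.mem_map, Submodule.mem_inf, Submodule.restrictScalars_mem,
    mem_homogeneousSubmodule, Submodule.mem_iInf, Finset.mem_range, LinearMap.mulLeft_apply]
  constructor
  · rintro ⟨⟨⟨hA, hT⟩, hJ⟩, hf⟩
    have hf0 : restrictLine f = 0 :=
      polynomial_eq_zero_of_multiple_roots ha haq (natDegree_restrictLine_le hf) (by omega)
        (fun i hi => restrictLine_dvd_of_mem_square (hA i hi)) (restrictLine_dvd_of_mem_pow hT)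
    obtain ⟨g, rfl⟩ := X_dvd_of_restrictLine_eq_zero hf hf0
    have hg : g.IsHomogeneous (e + 1) := isHomogeneous_of_X_mul 1 hf
    have hgT := mem_pow_of_X_mul_mem hT
    have hg0 : restrictLine g = 0 :=
      polynomial_eq_zero_of_multiple_roots ha haq (natDegree_restrictLine_le hg) (by omega)
        (fun i hi => restrictLine_dvd_of_X_mul_mem_square (hA i hi))
        (restrictLine_dvd_of_mem_pow hgT)
    obtain ⟨h, rfl⟩ := X_dvd_of_restrictLine_eq_zero hg hg0
    have hhT := mem_pow_of_X_mul_mem hgT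
    rw [pow_one] at hhT
    exact ⟨h, ⟨⟨hJy (hJy hJ), hhT⟩, isHomogeneous_of_X_mul 1 hg⟩, by ring⟩
  · rintro ⟨h, ⟨⟨hJ, hT⟩, hh⟩, rfl⟩
    refine ⟨⟨⟨fun i _ => Ideal.mul_mem_right _ _ (Ideal.subset_span (by simp)), ?_⟩,
      J.mul_mem_left _ hJ⟩, ?_⟩
    · rw [pow_succ]
      exact Ideal.mul_mem_mul (Ideal.pow_mem_pow (Ideal.subset_span (by simp)) 2) hT
    · rw [add_comm]
      exact (isHomogeneous_X_pow 1 2).mul hh
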